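/- With the reduction construction below, let σ : X → Y be a ρ-matching, and for each i let w_i = v_{j'} where σ(x_i) = p_{i'j'}. Then the vertices w_1,…,w_k are pairwise distinct and pairwise adjacent in G; that is, {w_1,…,w_k} is a k-clique in G. -/

import Mathlib

/-- Circular distance between the `j`-th and `j'`-th of `m` points spaced regularly
on a circle of perimeter 1: `(1/m) · min(j'−j, m+j−j')` for `j ≤ j'`. -/
noncomputable def ringDist (m : ℕ) (j j' : Fin m) : ℝ :=
  ((min (max j.val j'.val - min j.val j'.val)
        (m - (max j.val j'.val - min j.val j'.val)) : ℕ) : ℝ) / (m : ℝ)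

/-- The distance on `Y = R_1 ∪ … ∪ R_k`, where `R_i = {p_{i1},…,p_{im}}` and the
point `p_{ij}` (with `1 ≤ i ≤ k`, `1 ≤ j ≤ m`) is encoded as
`(⟨i-1⟩, ⟨j-1⟩) : Fin k × Fin m`.  Within a ring the distance is the circular
distance `ringDist`; for `i ≠ i'`, `d_Y(p_{ij}, p_{i'j'}) = 2^{max(i,i')}` if
`(v_j, v_{j'}) ∈ E` and `2^{max(i,i')} − 1/m` otherwise (note
`max(i,i') = max(i-1,i'-1) + 1` in the 0-indexed encoding). -/
noncomputable def dY (m k : ℕ) (G : SimpleGraph (Fin m)) [DecidableRel G.Adj]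
    (p q : Fin k × Fin m) : ℝ :=
  if p.1 = q.1 then ringDist m p.2 q.2
  else if G.Adj p.2 q.2 then (2 : ℝ) ^ (max p.1.val q.1.val + 1)
  else (2 : ℝ) ^ (max p.1.val q.1.val + 1) - 1 / (m : ℝ)

/-- The distance on the pattern `X = {x_1,…,x_k}` (point `x_i` encoded as
`⟨i-1⟩ : Fin k`): `d_X(x_i, x_{i'}) = 2^{max(i,i')} · ρ` for `i ≠ i'`. -/
noncomputable def dX (k : ℕ) (ρ : ℝ) (i i' : Fin k) : ℝ :=
  if i = i' then 0 else (2 : ℝ) ^ (max i.val i'.val + 1) * ρ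

/-- `σ` is a `ρ`-matching from `(A, dA)` to `(B, dB)`:
`(1/ρ)·dA(a,a') ≤ dB(σ a, σ a') ≤ ρ·dA(a,a')` for all `a, a'`. -/
def IsRhoMatching {A B : Type*} (dA : A → A → ℝ) (dB : B → B → ℝ)
    (ρ : ℝ) (σ : A → B) : Prop :=
  ∀ a a', (1 / ρ) * dA a a' ≤ dB (σ a) (σ a') ∧ dB (σ a) (σ a') ≤ ρ * dA a a'

theorem ringDist_le_one (m : ℕ) (j j' : Fin m) : ringDist m j j' ≤ 1 := by
  unfold ringDist
  refine div_le_one_of_le₀ ?_ (Nat.cast_nonneg m)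
  exact_mod_cast (min_le_right _ _).trans (Nat.sub_le _ _)

/-- An injective self-map of a finite type that does not decrease a weight on pairs of
distinct points preserves it. -/
theorem pairwise_eq_of_injective_of_le {α : Type*} [Finite α] {f : α → α}
    (hf : Function.Injective f) (w : α → α → ℕ)
    (h : ∀ a b, a ≠ b → w a b ≤ w (f a) (f b)) {a b : α} (hab : a ≠ b) :
    w a b = w (f a) (f b) := by
  classical
  cases nonempty_fintype α
  let u : α × α → ℕ := fun p => if p.1 = p.2 then 0 else w p.1 p.2
  have hle : ∀ p ∈ Finset.univ, u p ≤ u (Prod.map f f p) := by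
    rintro ⟨x, y⟩ -
    by_cases hxy : x = y
    · simp [u, hxy]
    · simpa [u, hxy, hf.ne hxy] using h x y hxy
  have hbij : Function.Bijective (Prod.map f f) := Finite.injective_iff_bijective.mp (hf.prodMap hf)
  have hsum := (hbij.sum_comp u).symm
  simpa [u, hab, hf.ne hab] using
    (Finset.sum_eq_sum_iff_of_le hle).mp hsum (a, b) (Finset.mem_univ _)

/-- **ρ-matching ⟹ clique.** With the reduction construction, if `σ : X → Y` is a
`ρ`-matching and `w_i = v_{j'}` where `σ(x_i) = p_{i'j'}` (so `w_i` is the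
second coordinate of `σ(x_i)`), then the vertices `w_1,…,w_k` are pairwise
distinct and pairwise adjacent in `G`; i.e. they form a `k`-clique. -/
theorem stmt_8 (m k : ℕ) (hm : 24 ≤ m) (hk : 1 ≤ k) (hkm : k ≤ m)
    (ρ : ℝ) (hρ : 1 ≤ ρ) (G : SimpleGraph (Fin m)) [DecidableRel G.Adj]
    (σ : Fin k → Fin k × Fin m)
    (hσ : IsRhoMatching (dX k ρ) (dY m k G) ρ σ) :
    ∀ i i' : Fin k, i ≠ i' →
      (σ i).2 ≠ (σ i').2 ∧ G.Adj (σ i).2 (σ i').2 := by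
  have hm0 : (0 : ℝ) < 1 / (m : ℝ) := by
    have : (0 : ℝ) < m := by exact_mod_cast (by omega : 0 < m)
    positivity
  have hlow : ∀ i i' : Fin k, i ≠ i' →
      (2 : ℝ) ^ (max i.val i'.val + 1) ≤ dY m k G (σ i) (σ i') := by
    intro i i' hne
    have h := (hσ i i').1
    have hρ0 : ρ ≠ 0 := by linarith
    rw [dX, if_neg hne, one_div, mul_comm _ ρ, inv_mul_cancel_left₀ hρ0] at h
    exact h
  have hinj : Function.Injective fun i => (σ i).1 := by
    intro i i' heq
    by_contra hne
    have h := hlow i i' hne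
    rw [dY, if_pos heq] at h
    have h1 := ringDist_le_one m (σ i).2 (σ i').2
    have h2 : (1 : ℝ) < 2 ^ (max i.val i'.val + 1) :=
      one_lt_pow₀ one_lt_two (Nat.succ_ne_zero _)
    linarith
  have hmax : ∀ i i' : Fin k, i ≠ i' →
      max i.val i'.val ≤ max (σ i).1.val (σ i').1.val := by
    intro i i' hne
    have h : (2 : ℝ) ^ (max i.val i'.val + 1) ≤ 2 ^ (max (σ i).1.val (σ i').1.val + 1) := by
      refine (hlow i i' hne).trans ?_
      rw [dY, if_neg (hinj.ne hne)]
      split_ifs <;> linarith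
    have := (pow_le_pow_iff_right₀ (one_lt_two (α := ℝ))).mp h
    omega
  intro i i' hne
  have heq := pairwise_eq_of_injective_of_le hinj (fun a b => max a.val b.val) hmax hne
  have hadj : G.Adj (σ i).2 (σ i').2 := by
    by_contra hnadj
    have h := hlow i i' hne
    rw [dY, if_neg (hinj.ne hne), if_neg hnadj] at h
    rw [heq] at h
    linarith
  exact ⟨hadj.ne, hadj⟩
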